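/- arXiv:0807.1604 — 2 statements merged into one kernel-verified Lean document; each statement's English description precedes it below -/
import Mathlib

section
/- Let 𝔤 be a finite-dimensional real Lie algebra and let σ and σ' be two commuting involutions of 𝔤, with 𝔥 := ker(σ − id), 𝔮 := ker(σ + id), 𝔥' := ker(σ' − id), 𝔮' := ker(σ' + id). Then the normalizer of 𝔮 ∩ 𝔥' in 𝔥 equals (𝔥 ∩ 𝔥') + 𝔷_{𝔥∩𝔮'}(𝔮 ∩ 𝔥'); that is, {X ∈ 𝔥 : [X, 𝔮 ∩ 𝔥'] ⊆ 𝔮 ∩ 𝔥'} = (𝔥 ∩ 𝔥') + {X ∈ 𝔥 ∩ 𝔮' : [X, w] = 0 for all w ∈ 𝔮 ∩ 𝔥'}. (Remark 1.4(i).) -/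
section

variable {𝔤 : Type*} [LieRing 𝔤] [LieAlgebra ℝ 𝔤]

/-- The `+1`-eigenspace `ker (σ - id)` of a linear involution. -/
def fixedSpace (σ : 𝔤 →ₗ⁅ℝ⁆ 𝔤) : Submodule ℝ 𝔤 :=
  LinearMap.ker (σ.toLinearMap - (LinearMap.id : 𝔤 →ₗ[ℝ] 𝔤))

/-- The `-1`-eigenspace `ker (σ + id)` of a linear involution. -/
def antifixedSpace (σ : 𝔤 →ₗ⁅ℝ⁆ 𝔤) : Submodule ℝ 𝔤 :=
  LinearMap.ker (σ.toLinearMap + (LinearMap.id : 𝔤 →ₗ[ℝ] 𝔤))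

/-- The normalizer `𝔫_V(W) = {X ∈ V : [X, W] ⊆ W}` of a subspace `W` in a subspace `V`;
note that `(-(ad w)) X = ⁅X, w⁆`. -/
def normalizerIn (V W : Submodule ℝ 𝔤) : Submodule ℝ 𝔤 :=
  V ⊓ ⨅ w ∈ W, Submodule.comap (-(LieAlgebra.ad ℝ 𝔤 w) : 𝔤 →ₗ[ℝ] 𝔤) W

/-- The centralizer `𝔷_V(W) = {X ∈ V : [X, w] = 0 for all w ∈ W}` of a subspace `W` in a
subspace `V`; note that `(-(ad w)) X = ⁅X, w⁆`. -/
def centralizerIn (V W : Submodule ℝ 𝔤) : Submodule ℝ 𝔤 :=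
  V ⊓ ⨅ w ∈ W, LinearMap.ker (-(LieAlgebra.ad ℝ 𝔤 w) : 𝔤 →ₗ[ℝ] 𝔤)

end

section

variable {𝔤 : Type*} [LieRing 𝔤] [LieAlgebra ℝ 𝔤]

theorem mem_fixedSpace {σ : 𝔤 →ₗ⁅ℝ⁆ 𝔤} {X : 𝔤} : X ∈ fixedSpace σ ↔ σ X = X := by
  simp [fixedSpace, sub_eq_zero]

theorem mem_antifixedSpace {σ : 𝔤 →ₗ⁅ℝ⁆ 𝔤} {X : 𝔤} : X ∈ antifixedSpace σ ↔ σ X = -X := by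
  simp [antifixedSpace, add_eq_zero_iff_eq_neg]

theorem mem_normalizerIn {V W : Submodule ℝ 𝔤} {X : 𝔤} :
    X ∈ normalizerIn V W ↔ X ∈ V ∧ ∀ w ∈ W, ⁅X, w⁆ ∈ W := by
  simp only [normalizerIn, Submodule.mem_inf, Submodule.mem_iInf, Submodule.mem_comap,
    LinearMap.neg_apply, LieAlgebra.ad_apply, lie_skew]

theorem mem_centralizerIn {V W : Submodule ℝ 𝔤} {X : 𝔤} :
    X ∈ centralizerIn V W ↔ X ∈ V ∧ ∀ w ∈ W, ⁅X, w⁆ = 0 := by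
  simp only [centralizerIn, Submodule.mem_inf, Submodule.mem_iInf, LinearMap.mem_ker,
    LinearMap.neg_apply, LieAlgebra.ad_apply, lie_skew]

end

/-- **Remark 1.4 (i).**
Let `𝔤` be a finite-dimensional real Lie algebra and `σ`, `σ'` two commuting involutions of
`𝔤`, with `𝔥 := ker (σ - id)`, `𝔮 := ker (σ + id)`, `𝔥' := ker (σ' - id)`,
`𝔮' := ker (σ' + id)`.  Then `𝔫_𝔥(𝔮 ∩ 𝔥') = (𝔥 ∩ 𝔥') + 𝔷_{𝔥 ∩ 𝔮'}(𝔮 ∩ 𝔥')`. -/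
theorem normalizer_eq_sup_centralizer
    (𝔤 : Type*) [LieRing 𝔤] [LieAlgebra ℝ 𝔤] [FiniteDimensional ℝ 𝔤]
    (σ σ' : 𝔤 →ₗ⁅ℝ⁆ 𝔤) (hσinv : ∀ X, σ (σ X) = X) (hσ'inv : ∀ X, σ' (σ' X) = X)
    (hcomm : ∀ X, σ (σ' X) = σ' (σ X)) :
    normalizerIn (fixedSpace σ) (antifixedSpace σ ⊓ fixedSpace σ')
      = (fixedSpace σ ⊓ fixedSpace σ') ⊔
        centralizerIn (fixedSpace σ ⊓ antifixedSpace σ')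
          (antifixedSpace σ ⊓ fixedSpace σ') := by
  apply le_antisymm
  · intro X hX
    obtain ⟨hXσ, hXn⟩ := mem_normalizerIn.1 hX
    rw [mem_fixedSpace] at hXσ
    refine Submodule.mem_sup.2 ⟨(2⁻¹ : ℝ) • (X + σ' X), ⟨?_, ?_⟩, (2⁻¹ : ℝ) • (X - σ' X),
      mem_centralizerIn.2 ⟨⟨?_, ?_⟩, fun w hw => ?_⟩, by module⟩
    · simp [mem_fixedSpace, hcomm, hXσ]
    · simp [mem_fixedSpace, hσ'inv, add_comm]
    · simp [mem_fixedSpace, hcomm, hXσ]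
    · simp [mem_antifixedSpace, hσ'inv, -smul_neg]
    · have hbracket := mem_fixedSpace.1 (hXn w hw).2
      rw [LieHom.map_lie, mem_fixedSpace.1 hw.2] at hbracket
      simp [hbracket]
  · refine sup_le ?_ ?_
    · rintro X ⟨hXσ, hXσ'⟩
      refine mem_normalizerIn.2 ⟨hXσ, fun w hw => ⟨?_, ?_⟩⟩
      · simp [mem_antifixedSpace, mem_fixedSpace.1 hXσ, mem_antifixedSpace.1 hw.1]
      · simp [mem_fixedSpace, mem_fixedSpace.1 hXσ', mem_fixedSpace.1 hw.2]
    · intro X hX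
      obtain ⟨hXV, hXz⟩ := mem_centralizerIn.1 hX
      refine mem_normalizerIn.2 ⟨hXV.1, fun w hw => ?_⟩
      rw [hXz w hw]
      exact Submodule.zero_mem _
end

section
/- Let 𝔤 be a finite-dimensional real semisimple Lie algebra, σ an involution of 𝔤 with 𝔥 := ker(σ − id) and 𝔮 := ker(σ + id), and θ a Cartan involution of 𝔤 commuting with σ, with 𝔣 := ker(θ − id) and 𝔭 := ker(θ + id). Then the normalizer of 𝔮 ∩ 𝔣 in 𝔥 satisfies 𝔫_𝔥(𝔮 ∩ 𝔣) = (𝔥 ∩ 𝔣) + 𝔷_{𝔥∩𝔭}(𝔮 ∩ 𝔣), and the restriction of the Killing form B of 𝔤 to this subspace 𝔫_𝔥(𝔮 ∩ 𝔣) is nondegenerate. (Remark 1.4(ii).) -/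
section

variable {𝔤 : Type*} [LieRing 𝔤] [LieAlgebra ℝ 𝔤]

/-- If `θ` fixes `W` pointwise, then `X` and `θ X` act identically on `W` for `X` normalizing `W`. -/
theorem map_lie_eq_of_mem_normalizerIn {θ : 𝔤 →ₗ⁅ℝ⁆ 𝔤} {V W : Submodule ℝ 𝔤}
    (hW : W ≤ fixedSpace θ) {X : 𝔤} (hX : X ∈ normalizerIn V W) {w : 𝔤} (hw : w ∈ W) :
    ⁅θ X, w⁆ = ⁅X, w⁆ := by
  have h := mem_fixedSpace.1 (hW ((mem_normalizerIn.1 hX).2 w hw))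
  rwa [LieHom.map_lie, mem_fixedSpace.1 (hW hw)] at h

/-- If `θ` preserves `V` and fixes `W` pointwise, then it preserves the normalizer of `W` in `V`. -/
theorem map_mem_normalizerIn {θ : 𝔤 →ₗ⁅ℝ⁆ 𝔤} {V W : Submodule ℝ 𝔤}
    (hV : ∀ X ∈ V, θ X ∈ V) (hW : W ≤ fixedSpace θ) {X : 𝔤} (hX : X ∈ normalizerIn V W) :
    θ X ∈ normalizerIn V W :=
  mem_normalizerIn.2 ⟨hV X (mem_normalizerIn.1 hX).1, fun w hw => by
    rw [map_lie_eq_of_mem_normalizerIn hW hX hw]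
    exact (mem_normalizerIn.1 hX).2 w hw⟩

theorem normalizerIn_fixedSpace_eq_sup {σ θ : 𝔤 →ₗ⁅ℝ⁆ 𝔤} (hθinv : ∀ X, θ (θ X) = X)
    (hcomm : ∀ X, σ (θ X) = θ (σ X)) :
    normalizerIn (fixedSpace σ) (antifixedSpace σ ⊓ fixedSpace θ)
      = (fixedSpace σ ⊓ fixedSpace θ) ⊔
        centralizerIn (fixedSpace σ ⊓ antifixedSpace θ) (antifixedSpace σ ⊓ fixedSpace θ) := by
  apply le_antisymm
  · intro X hX
    have hσ : σ X = X := mem_fixedSpace.1 (mem_normalizerIn.1 hX).1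
    refine Submodule.mem_sup.2 ⟨(1 / 2 : ℝ) • (X + θ X), ?_, (1 / 2 : ℝ) • (X - θ X), ?_, ?_⟩
    · simp [mem_fixedSpace, hσ, hcomm, hθinv, add_comm]
    · refine mem_centralizerIn.2 ⟨?_, fun w hw => ?_⟩
      · simp [mem_fixedSpace, mem_antifixedSpace, hσ, hcomm, hθinv]
      · rw [smul_lie, sub_lie, map_lie_eq_of_mem_normalizerIn inf_le_right hX hw, sub_self,
          smul_zero]
    · module
  · refine sup_le (fun X hX => ?_) (fun X hX => ?_)
    · simp only [Submodule.mem_inf, mem_fixedSpace] at hX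
      refine mem_normalizerIn.2 ⟨mem_fixedSpace.2 hX.1, fun w hw => ?_⟩
      simp only [Submodule.mem_inf, mem_fixedSpace, mem_antifixedSpace] at hw ⊢
      simp [hX, hw]
    · obtain ⟨hV, hW⟩ := mem_centralizerIn.1 hX
      exact mem_normalizerIn.2 ⟨hV.1, fun w hw => hW w hw ▸ zero_mem _⟩

end

/-- **Remark 1.4 (ii).**
Let `𝔤` be a finite-dimensional real semisimple Lie algebra, `σ` an involution of `𝔤` with
`𝔥 := ker (σ - id)` and `𝔮 := ker (σ + id)`, and `θ` a Cartan involution of `𝔤` commuting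
with `σ`, with `𝔣 := ker (θ - id)` and `𝔭 := ker (θ + id)`.  Then
`𝔫_𝔥(𝔮 ∩ 𝔣) = (𝔥 ∩ 𝔣) + 𝔷_{𝔥 ∩ 𝔭}(𝔮 ∩ 𝔣)`, and the restriction of the Killing form
to `𝔫_𝔥(𝔮 ∩ 𝔣)` is nondegenerate. -/
theorem normalizer_eq_and_killing_nondegenerate
    (𝔤 : Type*) [LieRing 𝔤] [LieAlgebra ℝ 𝔤] [FiniteDimensional ℝ 𝔤]
    [LieAlgebra.IsSemisimple ℝ 𝔤]
    (σ θ : 𝔤 →ₗ⁅ℝ⁆ 𝔤) (hσinv : ∀ X, σ (σ X) = X) (hθinv : ∀ X, θ (θ X) = X)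
    (hθpos : ∀ X : 𝔤, X ≠ 0 → 0 < -(killingForm ℝ 𝔤 X (θ X)))
    (hcomm : ∀ X, σ (θ X) = θ (σ X)) :
    normalizerIn (fixedSpace σ) (antifixedSpace σ ⊓ fixedSpace θ)
        = (fixedSpace σ ⊓ fixedSpace θ) ⊔
          centralizerIn (fixedSpace σ ⊓ antifixedSpace θ)
            (antifixedSpace σ ⊓ fixedSpace θ) ∧
      ∀ X ∈ normalizerIn (fixedSpace σ) (antifixedSpace σ ⊓ fixedSpace θ),
        (∀ Y ∈ normalizerIn (fixedSpace σ) (antifixedSpace σ ⊓ fixedSpace θ),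
          killingForm ℝ 𝔤 X Y = 0) → X = 0 := by
  refine ⟨normalizerIn_fixedSpace_eq_sup hθinv hcomm, fun X hX hB => ?_⟩
  by_contra hne
  have hθX := map_mem_normalizerIn (θ := θ)
    (fun Y hY => mem_fixedSpace.2 (by rw [hcomm, mem_fixedSpace.1 hY])) inf_le_right hX
  have hpos := hθpos X hne
  rw [hB _ hθX, neg_zero] at hpos
  exact lt_irrefl 0 hpos
end
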